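/- Let Ω ⊆ ℝ² be open and bounded. Then for every 0 < α < 8π and every u ∈ W^{2,1}_{Δ,0}(Ω) with Δu ≠ 0 one has ∫_Ω exp(α |u(x)| / ‖Δu‖_{L¹(Ω)}) dx ≤ (8π/(8π − α)) |Ω|. For α = 8π the supremum over u ∈ W^{2,1}_{Δ,0}(Ω), Δu ≠ 0, of ∫_Ω exp(8π |u(x)| / ‖Δu‖_{L¹(Ω)}) dx is infinite. If Ω is a ball, the constant 8π/(8π − α) is sharp for each 0 < α < 8π. -/

import Mathlib

open MeasureTheory Filter Topology
open scoped ENNReal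

noncomputable section

/-- Euclidean space ℝⁿ. -/
abbrev Euc (n : ℕ) := EuclideanSpace ℝ (Fin n)

/-- The (pointwise) Laplacian of a function on ℝⁿ: the trace of the second derivative. -/
def lapl (n : ℕ) (φ : Euc n → ℝ) (x : Euc n) : ℝ :=
  ∑ i : Fin n,
    iteratedFDeriv ℝ 2 φ x ![EuclideanSpace.single i (1 : ℝ), EuclideanSpace.single i (1 : ℝ)]

/-- A test function on Ω: smooth and compactly supported inside Ω. -/
def IsTestFun (n : ℕ) (Ω : Set (Euc n)) (φ : Euc n → ℝ) : Prop :=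
  ContDiff ℝ (⊤ : ℕ∞) φ ∧ HasCompactSupport φ ∧ tsupport φ ⊆ Ω

/-- `u ∈ W₀^{1,1}(Ω)`: `u` is an L¹(Ω) limit of test functions whose gradients converge
in L¹(Ω) (i.e. `u` is in the closure of C_c^∞(Ω) in the W^{1,1} norm). -/
def MemW0_1_1 (n : ℕ) (Ω : Set (Euc n)) (u : Euc n → ℝ) : Prop :=
  IntegrableOn u Ω volume ∧
  ∃ φ : ℕ → Euc n → ℝ, (∀ k, IsTestFun n Ω (φ k)) ∧
    Tendsto (fun k => ∫ x in Ω, |φ k x - u x|) atTop (𝓝 0) ∧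
    ∃ g : Euc n → Euc n →L[ℝ] ℝ,
      IntegrableOn (fun x => ‖g x‖) Ω volume ∧
      Tendsto (fun k => ∫ x in Ω, ‖fderiv ℝ (φ k) x - g x‖) atTop (𝓝 0)

/-- `u ∈ W^{2,1}_Δ(Ω)` with distributional Laplacian `f ∈ L¹(Ω)`. -/
def MemW21Delta (n : ℕ) (Ω : Set (Euc n)) (u f : Euc n → ℝ) : Prop :=
  MemW0_1_1 n Ω u ∧ IntegrableOn f Ω volume ∧
    ∀ ψ : Euc n → ℝ, IsTestFun n Ω ψ →
      ∫ x in Ω, u x * lapl n ψ x = ∫ x in Ω, f x * ψ x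

/-- `u ∈ W^{2,1}_{Δ,0}(Ω)` with Laplacian `f`: `u` is an L¹(Ω) limit of test functions `φ k`
with `Δ(φ k) → f` in L¹(Ω) (closure of C_c^∞(Ω) in the norm ‖Δu‖₁). -/
def MemW21Delta0 (n : ℕ) (Ω : Set (Euc n)) (u f : Euc n → ℝ) : Prop :=
  IntegrableOn u Ω volume ∧ IntegrableOn f Ω volume ∧
  ∃ φ : ℕ → Euc n → ℝ, (∀ k, IsTestFun n Ω (φ k)) ∧
    Tendsto (fun k => ∫ x in Ω, |φ k x - u x|) atTop (𝓝 0) ∧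
    Tendsto (fun k => ∫ x in Ω, |lapl n (φ k) x - f x|) atTop (𝓝 0)

/-- The decreasing rearrangement `u*(t)` of `u` on Ω. -/
def decRearr (n : ℕ) (Ω : Set (Euc n)) (u : Euc n → ℝ) (t : ℝ) : ℝ :=
  sInf {s : ℝ | 0 ≤ s ∧ volume {x ∈ Ω | s < |u x|} ≤ ENNReal.ofReal t}

/-- `‖f‖_{L¹(Ω)}`. -/
def L1norm (n : ℕ) (Ω : Set (Euc n)) (f : Euc n → ℝ) : ℝ := ∫ x in Ω, |f x|

/-- ω_{n-1}: surface measure of the unit sphere in ℝⁿ. -/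
def omegaS (n : ℕ) : ℝ := 2 * Real.pi ^ ((n : ℝ) / 2) / Real.Gamma ((n : ℝ) / 2)

/-- c_n = 1/((n-2) ω_{n-1}). -/
def cConst (n : ℕ) : ℝ := 1 / (((n : ℝ) - 2) * omegaS n)

/-- `N*_V(t)`: the rearrangement of the Green function of the ball of volume V. -/
def NstarV (n : ℕ) (V t : ℝ) : ℝ :=
  if n = 2 then (1 / (4 * Real.pi)) * Real.log (V / t)
  else cConst n * (omegaS n / (n : ℝ)) ^ (((n : ℝ) - 2) / (n : ℝ)) *
    (t ^ (-(((n : ℝ) - 2) / (n : ℝ))) - V ^ (-(((n : ℝ) - 2) / (n : ℝ))))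

/-- `N*_∞(t)` (for n ≥ 3). -/
def NstarInf (n : ℕ) (t : ℝ) : ℝ :=
  cConst n * (omegaS n / (n : ℝ)) ^ (((n : ℝ) - 2) / (n : ℝ)) *
    t ^ (-(((n : ℝ) - 2) / (n : ℝ)))

/-- The maximal function `u**(t) = (1/t) ∫₀ᵗ u*(s) ds`. -/
def maximalFn (n : ℕ) (Ω : Set (Euc n)) (u : Euc n → ℝ) (t : ℝ) : ℝ :=
  (1 / t) * ∫ s in (0:ℝ)..t, decRearr n Ω u s

/-- `u ∈ L_exp(Ω)`. -/
def MemLexp (n : ℕ) (Ω : Set (Euc n)) (u : Euc n → ℝ) : Prop :=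
  ∃ M : ℝ, ∀ t : ℝ, 0 < t → t ≤ (volume Ω).toReal →
    decRearr n Ω u t / (1 + Real.log ((volume Ω).toReal / t)) ≤ M

/-- `u ∈ L_{exp,0}(Ω)`. -/
def MemLexp0 (n : ℕ) (Ω : Set (Euc n)) (u : Euc n → ℝ) : Prop :=
  MemLexp n Ω u ∧
    Tendsto (fun t : ℝ => maximalFn n Ω u t / Real.log (1 / t)) (𝓝[>] 0) (𝓝 0)

/-- `u ∈ L^{n/(n-2),∞}(Ω)`. -/
def MemWeakL (n : ℕ) (Ω : Set (Euc n)) (u : Euc n → ℝ) : Prop :=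
  ∃ M : ℝ, ∀ t : ℝ, 0 < t → t ≤ (volume Ω).toReal →
    t ^ (((n : ℝ) - 2) / (n : ℝ)) * decRearr n Ω u t ≤ M

/-- `u ∈ L₀^{n/(n-2),∞}(Ω)`. -/
def MemWeakL0 (n : ℕ) (Ω : Set (Euc n)) (u : Euc n → ℝ) : Prop :=
  MemWeakL n Ω u ∧
    Tendsto (fun t : ℝ => t ^ (((n : ℝ) - 2) / (n : ℝ)) * maximalFn n Ω u t) (𝓝[>] 0) (𝓝 0)

/-- `Λ_n^0(Ω)`: equals `L_{exp,0}(Ω)` if n = 2 and `L₀^{n/(n-2),∞}(Ω)` if n ≥ 3. -/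
def MemLambda0 (n : ℕ) (Ω : Set (Euc n)) (u : Euc n → ℝ) : Prop :=
  if n = 2 then MemLexp0 n Ω u else MemWeakL0 n Ω u

/-- The point of the plane with polar coordinates `(r, θ)`. -/
def polarPt (p : ℝ × ℝ) : Euc 2 := !₂[p.1 * Real.cos p.2, p.1 * Real.sin p.2]

lemma polarPt_eq_smul (r θ : ℝ) : polarPt (r, θ) = r • polarPt (1, θ) := by
  ext i; fin_cases i <;> simp [polarPt]

lemma norm_polarPt_sq (p : ℝ × ℝ) : ‖polarPt p‖ ^ 2 = p.1 ^ 2 := by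
  rw [EuclideanSpace.norm_sq_eq]
  simp only [polarPt, Fin.sum_univ_two, Real.norm_eq_abs, sq_abs]
  simp only [Matrix.cons_val_zero, Matrix.cons_val_one]
  linear_combination p.1 ^ 2 * Real.cos_sq_add_sin_sq p.2

lemma continuous_polarPt : Continuous polarPt := by
  unfold polarPt
  refine (PiLp.continuous_toLp 2 _).comp (continuous_pi fun i => ?_)
  fin_cases i <;> simp <;> fun_prop

/-- The measure preserving identification of `ℝ × ℝ` with the Euclidean plane. -/
def prodEquivEuc : ℝ × ℝ ≃ᵐ Euc 2 :=
  (MeasurableEquiv.finTwoArrow (α := ℝ)).symm.trans (MeasurableEquiv.toLp 2 (Fin 2 → ℝ))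

lemma measurePreserving_prodEquivEuc : MeasurePreserving prodEquivEuc :=
  (PiLp.volume_preserving_toLp (Fin 2)).comp (volume_preserving_finTwoArrow ℝ).symm

lemma prodEquivEuc_polarCoord_symm (p : ℝ × ℝ) :
    prodEquivEuc (polarCoord.symm p) = polarPt p := by
  ext i; fin_cases i <;> simp [polarPt, prodEquivEuc, polarCoord]

lemma lintegral_eq_polar (f : Euc 2 → ℝ≥0∞) :
    ∫⁻ z, f z = ∫⁻ p in Set.Ioi (0 : ℝ) ×ˢ Set.Ioo (-Real.pi) Real.pi,
      ENNReal.ofReal p.1 * f (polarPt p) := by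
  rw [← measurePreserving_prodEquivEuc.lintegral_comp_emb prodEquivEuc.measurableEmbedding,
    ← lintegral_comp_polarCoord_symm]
  simp only [prodEquivEuc_polarCoord_symm, smul_eq_mul]
  rfl

lemma apply_polarPt (L : Euc 2 →L[ℝ] ℝ) (r θ : ℝ) :
    L (polarPt (r, θ)) = r * (L (EuclideanSpace.single 0 1) * Real.cos θ +
      L (EuclideanSpace.single 1 1) * Real.sin θ) := by
  have : polarPt (r, θ) = (r * Real.cos θ) • EuclideanSpace.single (0 : Fin 2) (1 : ℝ) +
      (r * Real.sin θ) • EuclideanSpace.single (1 : Fin 2) (1 : ℝ) := by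
    ext i; fin_cases i <;> simp [polarPt]
  rw [this, map_add, map_smul, map_smul]
  simp only [smul_eq_mul]; ring

/-- The Euclidean length of the coordinate vector of a linear form on the plane. -/
def gradLen (L : Euc 2 →L[ℝ] ℝ) : ℝ :=
  √(L (EuclideanSpace.single 0 1) ^ 2 + L (EuclideanSpace.single 1 1) ^ 2)

lemma gradLen_nonneg (L : Euc 2 →L[ℝ] ℝ) : 0 ≤ gradLen L := Real.sqrt_nonneg _

lemma gradLen_sq (L : Euc 2 →L[ℝ] ℝ) :
    gradLen L ^ 2 = L (EuclideanSpace.single 0 1) ^ 2 + L (EuclideanSpace.single 1 1) ^ 2 :=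
  Real.sq_sqrt (by positivity)

lemma continuous_gradLen : Continuous gradLen := by
  unfold gradLen; fun_prop

lemma gradLen_smul {c : ℝ} (hc : 0 ≤ c) (L : Euc 2 →L[ℝ] ℝ) : gradLen (c • L) = c * gradLen L := by
  unfold gradLen
  rw [← Real.sqrt_sq hc, ← Real.sqrt_mul (sq_nonneg _), Real.sqrt_sq hc]
  congr 1
  simp only [smul_apply, smul_eq_mul]; ring

lemma gradLen_eq_zero {L : Euc 2 →L[ℝ] ℝ} (h : gradLen L = 0) (z : Euc 2) : L z = 0 := by
  have h2 := gradLen_sq L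
  rw [h] at h2
  have h0 : L (EuclideanSpace.single 0 1) = 0 := by
    nlinarith [sq_nonneg (L (EuclideanSpace.single 0 1)), sq_nonneg (L (EuclideanSpace.single 1 1))]
  have h1 : L (EuclideanSpace.single 1 1) = 0 := by
    nlinarith [sq_nonneg (L (EuclideanSpace.single 0 1)), sq_nonneg (L (EuclideanSpace.single 1 1))]
  have : z = z 0 • EuclideanSpace.single (0 : Fin 2) (1 : ℝ) +
      z 1 • EuclideanSpace.single (1 : Fin 2) (1 : ℝ) := by
    ext i; fin_cases i <;> simp
  rw [this, map_add, map_smul, map_smul, h0, h1]; simp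

lemma integral_sq_max_trig (a b : ℝ) :
    ∫ θ in -Real.pi..Real.pi, (max (a * Real.cos θ + b * Real.sin θ) 0) ^ 2 =
      Real.pi * (a ^ 2 + b ^ 2) / 2 := by
  have hc : Continuous fun θ : ℝ => (max (a * Real.cos θ + b * Real.sin θ) 0) ^ 2 := by fun_prop
  have h1 : ∫ θ in -Real.pi..0, (max (a * Real.cos θ + b * Real.sin θ) 0) ^ 2 =
      ∫ θ in (0 : ℝ)..Real.pi, (max (-(a * Real.cos θ + b * Real.sin θ)) 0) ^ 2 := by
    have := intervalIntegral.integral_comp_sub_right (a := 0) (b := Real.pi)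
      (fun θ : ℝ => (max (a * Real.cos θ + b * Real.sin θ) 0) ^ 2) Real.pi
    rw [zero_sub, sub_self] at this
    rw [← this]
    congr 1; ext θ
    rw [Real.cos_sub_pi, Real.sin_sub_pi]; ring_nf
  rw [← intervalIntegral.integral_add_adjacent_intervals (b := 0) (hc.intervalIntegrable _ _)
    (hc.intervalIntegrable _ _), h1, ← intervalIntegral.integral_add
    ((by fun_prop : Continuous _).intervalIntegrable _ _) (hc.intervalIntegrable _ _)]
  have h2 : ∀ θ : ℝ, (max (-(a * Real.cos θ + b * Real.sin θ)) 0) ^ 2 +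
      (max (a * Real.cos θ + b * Real.sin θ) 0) ^ 2 = (a * Real.cos θ + b * Real.sin θ) ^ 2 := by
    intro θ
    rcases le_total 0 (a * Real.cos θ + b * Real.sin θ) with h | h
    · rw [max_eq_left h, max_eq_right (by linarith)]; ring
    · rw [max_eq_right h, max_eq_left (by linarith)]; ring
  simp_rw [h2]
  have h3 : ∀ θ : ℝ, HasDerivAt (fun θ : ℝ => (a ^ 2 + b ^ 2) / 2 * θ +
      (a ^ 2 - b ^ 2) / 2 * (Real.sin θ * Real.cos θ) + a * b * Real.sin θ ^ 2)
      ((a * Real.cos θ + b * Real.sin θ) ^ 2) θ := by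
    intro θ
    convert! (((hasDerivAt_id θ).const_mul ((a ^ 2 + b ^ 2) / 2)).add
      (((Real.hasDerivAt_sin θ).mul (Real.hasDerivAt_cos θ)).const_mul ((a ^ 2 - b ^ 2) / 2))).add
      (((Real.hasDerivAt_sin θ).pow 2).const_mul (a * b)) using 1
    simp
    linear_combination (a ^ 2 + b ^ 2) / 2 * Real.cos_sq_add_sin_sq θ
  rw [intervalIntegral.integral_eq_sub_of_hasDerivAt (fun θ _ => h3 θ)
    ((by fun_prop : Continuous _).intervalIntegrable _ _)]
  simp; ring

lemma lintegral_ofReal_sub_mul_le (c : ℝ) {l : ℝ} (hl : 0 < l) :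
    ∫⁻ r in Set.Ioi (0 : ℝ), ENNReal.ofReal (c - l * r) ≤
      ENNReal.ofReal ((max c 0) ^ 2 / (2 * l)) := by
  set d := max c 0 / l with hd
  have hd0 : 0 ≤ d := by positivity
  have h1 : ∀ r ∈ Set.Ioi (0 : ℝ), ENNReal.ofReal (c - l * r) ≤
      (Set.Ioc 0 d).indicator (fun r => ENNReal.ofReal (max c 0 - l * r)) r := by
    intro r hr
    by_cases h : r ≤ d
    · rw [Set.indicator_of_mem (Set.mem_Ioc.2 ⟨hr, h⟩)]
      exact ENNReal.ofReal_le_ofReal (by linarith [le_max_left c 0])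
    · rw [ENNReal.ofReal_of_nonpos]
      · exact zero_le
      · rw [not_le, hd, div_lt_iff₀ hl] at h
        linarith [le_max_left c 0]
  refine (setLIntegral_mono' measurableSet_Ioi h1).trans ?_
  refine (setLIntegral_le_lintegral _ _).trans ?_
  rw [lintegral_indicator measurableSet_Ioc, ← ofReal_integral_eq_lintegral_ofReal,
    ← intervalIntegral.integral_of_le hd0]
  · apply ENNReal.ofReal_le_ofReal
    have h3 : ∀ r : ℝ, HasDerivAt (fun r : ℝ => max c 0 * r - l / 2 * r ^ 2) (max c 0 - l * r) r := by
      intro r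
      convert! ((hasDerivAt_id r).const_mul (max c 0)).sub
        (((hasDerivAt_id r).pow 2).const_mul (l / 2)) using 1
      simp; ring
    rw [intervalIntegral.integral_eq_sub_of_hasDerivAt (fun θ _ => h3 θ)
      ((by fun_prop : Continuous _).intervalIntegrable _ _)]
    apply le_of_eq
    rw [hd]; field_simp; ring
  · exact (by fun_prop : Continuous fun r : ℝ => max c 0 - l * r).integrableOn_Ioc
  · refine (ae_restrict_iff' measurableSet_Ioc).2 (ae_of_all _ fun r hr => ?_)
    have := hr.2
    rw [hd, le_div_iff₀ hl] at this
    simp only [Pi.zero_apply]; linarith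

lemma lintegral_kernel_sub_le (L : Euc 2 →L[ℝ] ℝ) {l : ℝ} (hl : 0 < l) :
    ∫⁻ z, ENNReal.ofReal (L z / ‖z‖ ^ 2 - l * gradLen L) ≤
      ENNReal.ofReal (gradLen L * (Real.pi / (4 * l))) := by
  rcases (gradLen_nonneg L).eq_or_lt with h0 | h0
  · simp [← h0, gradLen_eq_zero h0.symm]
  set a := L (EuclideanSpace.single 0 1)
  set b := L (EuclideanSpace.single 1 1)
  have hm : Measurable fun p : ℝ × ℝ =>
      ENNReal.ofReal (a * Real.cos p.2 + b * Real.sin p.2 - l * gradLen L * p.1) := by fun_prop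
  rw [lintegral_eq_polar]
  calc _ = ∫⁻ p in Set.Ioi (0 : ℝ) ×ˢ Set.Ioo (-Real.pi) Real.pi,
        ENNReal.ofReal (a * Real.cos p.2 + b * Real.sin p.2 - l * gradLen L * p.1) := by
        refine setLIntegral_congr_fun (measurableSet_Ioi.prod measurableSet_Ioo) ?_
        rintro ⟨r, θ⟩ ⟨hr, -⟩
        have hr : 0 < r := hr
        simp only
        rw [← ENNReal.ofReal_mul hr.le, norm_polarPt_sq, apply_polarPt]
        congr 1
        field_simp
        ring
    _ = ∫⁻ θ in Set.Ioo (-Real.pi) Real.pi, ∫⁻ r in Set.Ioi (0 : ℝ),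
        ENNReal.ofReal (a * Real.cos θ + b * Real.sin θ - l * gradLen L * r) := by
        rw [Measure.volume_eq_prod, ← Measure.prod_restrict, lintegral_prod_symm' _ hm]
    _ ≤ ∫⁻ θ in Set.Ioo (-Real.pi) Real.pi, ENNReal.ofReal
          ((max (a * Real.cos θ + b * Real.sin θ) 0) ^ 2 / (2 * (l * gradLen L))) :=
        lintegral_mono fun θ => lintegral_ofReal_sub_mul_le _ (by positivity)
    _ = ENNReal.ofReal (Real.pi * (a ^ 2 + b ^ 2) / 2 / (2 * (l * gradLen L))) := by
        rw [Measure.restrict_congr_set (Ioo_ae_eq_Ioc (μ := volume)),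
          ← ofReal_integral_eq_lintegral_ofReal]
        · rw [integral_div, ← intervalIntegral.integral_of_le (by linarith [Real.pi_pos]),
            integral_sq_max_trig]
        · exact (by fun_prop : Continuous fun θ : ℝ => (max (a * Real.cos θ + b * Real.sin θ) 0) ^ 2 /
            (2 * (l * gradLen L))).integrableOn_Ioc
        · exact ae_of_all _ fun θ => by simp only [Pi.zero_apply]; positivity
    _ = _ := by
        rw [← gradLen_sq]
        congr 1
        field_simp
        ring

lemma ofReal_integral_le_lintegral_ofReal {X : Type*} [MeasurableSpace X] {μ : Measure X}
    {f : X → ℝ} (hf : Integrable f μ) :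
    ENNReal.ofReal (∫ x, f x ∂μ) ≤ ∫⁻ x, ENNReal.ofReal (f x) ∂μ := by
  rw [integral_eq_lintegral_pos_part_sub_lintegral_neg_part hf]
  refine (ENNReal.ofReal_le_ofReal (sub_le_self _ ENNReal.toReal_nonneg)).trans ?_
  exact ENNReal.ofReal_toReal_le

lemma ofReal_le_lintegral_Ioi_fderiv {w : Euc 2 → ℝ} (hw : ContDiff ℝ 1 w)
    (hc : HasCompactSupport w) (x e : Euc 2) (he : ‖e‖ = 1) :
    ENNReal.ofReal (w x) ≤
      ∫⁻ r in Set.Ioi (0 : ℝ), ENNReal.ofReal (-(fderiv ℝ w (x + r • e) e)) := by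
  have hline : Isometry fun r : ℝ => x + r • e := by
    refine Isometry.of_dist_eq fun a b => ?_
    rw [dist_add_left, dist_eq_norm, ← sub_smul, norm_smul, he, mul_one, Real.dist_eq,
      Real.norm_eq_abs]
  have hcd : ContDiff ℝ 1 fun r : ℝ => w (x + r • e) := by fun_prop
  have hcs : HasCompactSupport fun r : ℝ => w (x + r • e) :=
    hc.comp_isClosedEmbedding hline.isClosedEmbedding
  have hd : ∀ r : ℝ, deriv (fun r : ℝ => w (x + r • e)) r = fderiv ℝ w (x + r • e) e := by
    intro r
    have h1 : HasDerivAt (fun r : ℝ => x + r • e) e r := by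
      simpa using ((hasDerivAt_id r).smul_const e).const_add x
    exact ((hw.differentiable one_ne_zero _).hasFDerivAt.comp_hasDerivAt r h1).deriv
  have h1 := hcs.integral_Ioi_deriv_eq hcd 0
  have h2 : Integrable (deriv fun r : ℝ => w (x + r • e)) :=
    (hcd.continuous_deriv le_rfl).integrable_of_hasCompactSupport hcs.deriv
  have h3 := ofReal_integral_le_lintegral_ofReal h2.neg.integrableOn (μ := volume.restrict (Set.Ioi 0))
  simp only [Pi.neg_apply, integral_neg] at h3
  rw [h1] at h3
  simpa [hd] using h3

lemma norm_polarPt_one (θ : ℝ) : ‖polarPt (1, θ)‖ = 1 := by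
  rw [← pow_left_inj₀ (norm_nonneg _) zero_le_one two_ne_zero, norm_polarPt_sq]

lemma ofReal_le_lintegral_kernel {w : Euc 2 → ℝ} (hw : ContDiff ℝ 1 w)
    (hc : HasCompactSupport w) (x : Euc 2) :
    ENNReal.ofReal (2 * Real.pi) * ENNReal.ofReal (w x) ≤
      ∫⁻ y, ENNReal.ofReal (fderiv ℝ w y (x - y) / ‖x - y‖ ^ 2) := by
  have hdc : Continuous (fderiv ℝ w) := hw.continuous_fderiv one_ne_zero
  have hm : Measurable fun p : ℝ × ℝ =>
      ENNReal.ofReal (-(fderiv ℝ w (x + p.1 • polarPt (1, p.2)) (polarPt (1, p.2)))) := by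
    have h1 : Continuous fun p : ℝ × ℝ => polarPt (1, p.2) :=
      continuous_polarPt.comp (by fun_prop)
    exact ENNReal.measurable_ofReal.comp (Continuous.measurable (by fun_prop))
  rw [← lintegral_add_left_eq_self _ x, lintegral_eq_polar]
  calc ENNReal.ofReal (2 * Real.pi) * ENNReal.ofReal (w x)
      = ∫⁻ θ in Set.Ioo (-Real.pi) Real.pi, ENNReal.ofReal (w x) := by
        rw [setLIntegral_const, Real.volume_Ioo, mul_comm]
        congr 2; ring
    _ ≤ ∫⁻ θ in Set.Ioo (-Real.pi) Real.pi, ∫⁻ r in Set.Ioi (0 : ℝ),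
          ENNReal.ofReal (-(fderiv ℝ w (x + r • polarPt (1, θ)) (polarPt (1, θ)))) :=
        lintegral_mono fun θ => ofReal_le_lintegral_Ioi_fderiv hw hc x _ (norm_polarPt_one θ)
    _ = ∫⁻ p in Set.Ioi (0 : ℝ) ×ˢ Set.Ioo (-Real.pi) Real.pi,
          ENNReal.ofReal (-(fderiv ℝ w (x + p.1 • polarPt (1, p.2)) (polarPt (1, p.2)))) := by
        rw [Measure.volume_eq_prod, ← Measure.prod_restrict, lintegral_prod_symm' _ hm]
    _ = _ := by
        refine setLIntegral_congr_fun (measurableSet_Ioi.prod measurableSet_Ioo) ?_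
        rintro ⟨r, θ⟩ ⟨hr, -⟩
        have hr : 0 < r := hr
        simp only
        rw [← ENNReal.ofReal_mul hr.le, sub_add_cancel_left, norm_neg, norm_polarPt_sq,
          polarPt_eq_smul r θ, map_neg, map_smul, smul_eq_mul]
        congr 1
        field_simp

lemma lintegral_kernel_le (L : Euc 2 →L[ℝ] ℝ) (y : Euc 2) {K : Set (Euc 2)} {l : ℝ} (hl : 0 < l) :
    ∫⁻ x in K, ENNReal.ofReal (L (x - y) / ‖x - y‖ ^ 2) ≤
      ENNReal.ofReal (gradLen L) * (ENNReal.ofReal l * volume K + ENNReal.ofReal (Real.pi / (4 * l))) := by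
  have hG := gradLen_nonneg L
  calc ∫⁻ x in K, ENNReal.ofReal (L (x - y) / ‖x - y‖ ^ 2)
      ≤ ∫⁻ x in K, (ENNReal.ofReal (l * gradLen L) +
          ENNReal.ofReal (L (x - y) / ‖x - y‖ ^ 2 - l * gradLen L)) := by
        refine lintegral_mono fun x => ?_
        refine le_trans (ENNReal.ofReal_le_ofReal ?_) ENNReal.ofReal_add_le
        linarith
    _ ≤ ENNReal.ofReal (l * gradLen L) * volume K +
          ∫⁻ x, ENNReal.ofReal (L (x - y) / ‖x - y‖ ^ 2 - l * gradLen L) := by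
        rw [lintegral_add_left measurable_const, setLIntegral_const]
        exact add_le_add le_rfl (setLIntegral_le_lintegral _ _)
    _ ≤ ENNReal.ofReal (l * gradLen L) * volume K +
          ENNReal.ofReal (gradLen L * (Real.pi / (4 * l))) := by
        refine add_le_add le_rfl ?_
        rw [lintegral_sub_right_eq_self
          (fun x : Euc 2 => ENNReal.ofReal (L x / ‖x‖ ^ 2 - l * gradLen L)) y]
        exact lintegral_kernel_sub_le L hl
    _ = _ := by
        rw [ENNReal.ofReal_mul hl.le, ENNReal.ofReal_mul hG]; ring

/-- A functional form of the isoperimetric inequality in the plane. -/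
lemma isoperimetric {w : Euc 2 → ℝ} (hw : ContDiff ℝ 1 w) (hc : HasCompactSupport w)
    {K : Set (Euc 2)} (hK : MeasurableSet K) (hKfin : volume K ≠ ∞) {m : ℝ} (hm : 0 ≤ m)
    (hmK : ∀ x ∈ K, m ≤ w x) :
    m * (2 * √(Real.pi * (volume K).toReal)) ≤ ∫ y, gradLen (fderiv ℝ w y) := by
  have hdc : Continuous (fderiv ℝ w) := hw.continuous_fderiv one_ne_zero
  have hGc : Continuous fun y => gradLen (fderiv ℝ w y) := continuous_gradLen.comp hdc
  have hGi : Integrable fun y => gradLen (fderiv ℝ w y) := by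
    refine hGc.integrable_of_hasCompactSupport ?_
    exact (hc.fderiv ℝ).comp_left (g := gradLen) (by simp [gradLen])
  have hI0 : 0 ≤ ∫ y, gradLen (fderiv ℝ w y) := integral_nonneg fun y => gradLen_nonneg _
  set k := (volume K).toReal with hk
  rcases (ENNReal.toReal_nonneg : 0 ≤ (volume K).toReal).eq_or_lt with h0 | h0
  · rw [hk, ← h0]; simpa using hI0
  have hk0 : 0 < k := h0
  have hvol : volume K = ENNReal.ofReal k := (ENNReal.ofReal_toReal hKfin).symm
  set s := √(Real.pi * k) with hs
  have hs0 : 0 < s := Real.sqrt_pos.2 (by positivity)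
  have hs2 : s ^ 2 = Real.pi * k := Real.sq_sqrt (by positivity)
  have hl : 0 < s / (2 * k) := by positivity
  have hkey : ENNReal.ofReal (2 * Real.pi * m * k) ≤
      ENNReal.ofReal ((∫ y, gradLen (fderiv ℝ w y)) * s) := by
    calc ENNReal.ofReal (2 * Real.pi * m * k)
        = ∫⁻ x in K, ENNReal.ofReal (2 * Real.pi) * ENNReal.ofReal m := by
          rw [setLIntegral_const, hvol, ← ENNReal.ofReal_mul (by positivity),
            ← ENNReal.ofReal_mul (by positivity)]
      _ ≤ ∫⁻ x in K, ∫⁻ y, ENNReal.ofReal (fderiv ℝ w y (x - y) / ‖x - y‖ ^ 2) := by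
          refine setLIntegral_mono' hK fun x hx => ?_
          refine le_trans ?_ (ofReal_le_lintegral_kernel hw hc x)
          gcongr
          exact hmK x hx
      _ = ∫⁻ y, ∫⁻ x in K, ENNReal.ofReal (fderiv ℝ w y (x - y) / ‖x - y‖ ^ 2) := by
          refine lintegral_lintegral_swap (Measurable.aemeasurable ?_)
          refine ENNReal.measurable_ofReal.comp (Measurable.div ?_ ?_)
          · exact Continuous.measurable (by fun_prop)
          · exact Continuous.measurable (by fun_prop)
      _ ≤ ∫⁻ y, ENNReal.ofReal (gradLen (fderiv ℝ w y)) *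
            (ENNReal.ofReal (s / (2 * k)) * volume K +
              ENNReal.ofReal (Real.pi / (4 * (s / (2 * k))))) :=
          lintegral_mono fun y => lintegral_kernel_le _ _ hl
      _ = ENNReal.ofReal (∫ y, gradLen (fderiv ℝ w y)) * ENNReal.ofReal s := by
          rw [lintegral_mul_const _ hGc.measurable.ennreal_ofReal,
            ofReal_integral_eq_lintegral_ofReal hGi (ae_of_all _ fun y => gradLen_nonneg _),
            hvol, ← ENNReal.ofReal_mul hl.le, ← ENNReal.ofReal_add (by positivity) (by positivity)]
          congr 2
          field_simp
          linarith [hs2]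
      _ = _ := (ENNReal.ofReal_mul hI0).symm
  rw [ENNReal.ofReal_le_ofReal_iff (by positivity)] at hkey
  refine le_of_mul_le_mul_right ?_ hs0
  calc m * (2 * s) * s = 2 * Real.pi * m * k := by linear_combination 2 * m * hs2
    _ ≤ _ := hkey

lemma lapl_eq_sum_fderiv {u : Euc 2 → ℝ} (hu : ContDiff ℝ 2 u) (x : Euc 2) :
    lapl 2 u x = ∑ i : Fin 2, fderiv ℝ (fun y => fderiv ℝ u y (EuclideanSpace.single i 1)) x
      (EuclideanSpace.single i 1) := by
  unfold lapl
  refine Finset.sum_congr rfl fun i _ => ?_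
  have hd : DifferentiableAt ℝ (fderiv ℝ u) x :=
    (hu.fderiv_right (m := 1) (by norm_num)).differentiable one_ne_zero x
  rw [iteratedFDeriv_two_apply, fderiv_clm_apply hd (differentiableAt_const _)]
  simp

lemma contDiff_fderiv_apply {u : Euc 2 → ℝ} (hu : ContDiff ℝ 2 u) (v : Euc 2) :
    ContDiff ℝ 1 fun y => fderiv ℝ u y v :=
  (hu.fderiv_right (m := 1) (by norm_num)).clm_apply contDiff_const

lemma continuous_lapl {u : Euc 2 → ℝ} (hu : ContDiff ℝ 2 u) : Continuous (lapl 2 u) := by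
  have : lapl 2 u = fun x => ∑ i : Fin 2,
      fderiv ℝ (fun y => fderiv ℝ u y (EuclideanSpace.single i 1)) x
      (EuclideanSpace.single i 1) := funext (lapl_eq_sum_fderiv hu)
  rw [this]
  refine continuous_finsetSum _ fun i _ => ?_
  exact ((contDiff_fderiv_apply hu _).continuous_fderiv one_ne_zero).clm_apply continuous_const

lemma hasCompactSupport_lapl {u : Euc 2 → ℝ} (hc : HasCompactSupport u) :
    HasCompactSupport (lapl 2 u) := by
  refine hc.mono' fun x hx => ?_
  by_contra h
  apply hx
  have h1 : u =ᶠ[𝓝 x] fun _ => 0 := notMem_tsupport_iff_eventuallyEq.1 h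
  unfold lapl
  refine Finset.sum_eq_zero fun i _ => ?_
  rw [(h1.iteratedFDeriv ℝ 2).eq_of_nhds]
  simp

lemma integrable_lapl {u : Euc 2 → ℝ} (hu : ContDiff ℝ 2 u) (hc : HasCompactSupport u) :
    Integrable (lapl 2 u) :=
  (continuous_lapl hu).integrable_of_hasCompactSupport (hasCompactSupport_lapl hc)

/-- Green's first identity for `g ∘ u` and `u`. -/
lemma integral_comp_mul_lapl {u : Euc 2 → ℝ} (hu : ContDiff ℝ 2 u) (hc : HasCompactSupport u)
    {g g' : ℝ → ℝ} (hg : ∀ t, HasDerivAt g (g' t) t) (hg' : Continuous g') :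
    ∫ x, g (u x) * lapl 2 u x = -∫ x, g' (u x) * gradLen (fderiv ℝ u x) ^ 2 := by
  have hgc : Continuous g := continuous_iff_continuousAt.2 fun t => (hg t).continuousAt
  have hfu : Continuous (fderiv ℝ u) := hu.continuous_fderiv two_ne_zero
  have hcu : ∀ v, HasCompactSupport fun x => fderiv ℝ u x v := fun v => hc.fderiv_apply ℝ v
  have hi1 : ∀ v : Euc 2, Integrable fun x => g (u x) * fderiv ℝ (fun y => fderiv ℝ u y v) x v := by
    intro v
    refine Continuous.integrable_of_hasCompactSupport ?_ ?_
    · exact (hgc.comp hu.continuous).mul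
        (((contDiff_fderiv_apply hu v).continuous_fderiv one_ne_zero).clm_apply continuous_const)
    · exact ((hcu v).fderiv_apply ℝ v).mul_left
  have hi2 : ∀ v : Euc 2, Integrable fun x => g' (u x) * (fderiv ℝ u x v) ^ 2 := by
    intro v
    refine Continuous.integrable_of_hasCompactSupport ?_ ?_
    · exact (hg'.comp hu.continuous).mul ((hfu.clm_apply continuous_const).pow 2)
    · exact HasCompactSupport.mul_left ((hcu v).comp_left (g := fun t => t ^ 2) (by simp))
  have hi3 : ∀ v : Euc 2, Integrable fun x => g (u x) * (fderiv ℝ u x v) := by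
    intro v
    refine Continuous.integrable_of_hasCompactSupport ?_ ?_
    · exact (hgc.comp hu.continuous).mul (hfu.clm_apply continuous_const)
    · exact (hcu v).mul_left
  have hder : ∀ x, HasFDerivAt (fun x => g (u x)) (g' (u x) • fderiv ℝ u x) x := fun x =>
    (hg (u x)).comp_hasFDerivAt x (hu.differentiable two_ne_zero x).hasFDerivAt
  have key : ∀ v : Euc 2, ∫ x, g (u x) * fderiv ℝ (fun y => fderiv ℝ u y v) x v =
      -∫ x, g' (u x) * (fderiv ℝ u x v) ^ 2 := by
    intro v
    have heq : ∀ x, fderiv ℝ (fun x => g (u x)) x v * fderiv ℝ u x v =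
        g' (u x) * (fderiv ℝ u x v) ^ 2 := by
      intro x
      rw [(hder x).fderiv]
      simp only [smul_apply, smul_eq_mul]
      ring
    rw [integral_mul_fderiv_eq_neg_fderiv_mul_of_integrable (μ := volume)]
    · simp_rw [heq]
    · simp_rw [heq]; exact hi2 v
    · exact hi1 v
    · exact hi3 v
    · exact fun x _ => (hder x).differentiableAt
    · exact fun x _ => (contDiff_fderiv_apply hu v).differentiable one_ne_zero x
  simp_rw [lapl_eq_sum_fderiv hu, gradLen_sq, Fin.sum_univ_two, mul_add]
  rw [integral_add (hi1 _) (hi1 _), integral_add (hi2 _) (hi2 _), key, key]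
  ring

lemma integral_lapl_eq_zero {u : Euc 2 → ℝ} (hu : ContDiff ℝ 2 u) (hc : HasCompactSupport u) :
    ∫ x, lapl 2 u x = 0 := by
  have := integral_comp_mul_lapl hu hc (g := fun _ => 1) (g' := fun _ => 0)
    (fun t => hasDerivAt_const t 1) continuous_const
  simpa using this

lemma integral_max_neg_lapl {u : Euc 2 → ℝ} (hu : ContDiff ℝ 2 u) (hc : HasCompactSupport u) :
    ∫ x, max (-lapl 2 u x) 0 = (∫ x, |lapl 2 u x|) / 2 := by
  have h : ∀ x, max (-lapl 2 u x) 0 = (|lapl 2 u x| - lapl 2 u x) / 2 := by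
    intro x
    rcases le_total 0 (lapl 2 u x) with h | h
    · rw [abs_of_nonneg h, max_eq_right (by linarith)]; ring
    · rw [abs_of_nonpos h, max_eq_left (by linarith)]; ring
  have hi := integrable_lapl hu hc
  simp_rw [h]
  rw [integral_div, integral_sub hi.abs hi, integral_lapl_eq_zero hu hc, sub_zero]

lemma volume_superlevel_ne_top {u : Euc 2 → ℝ} (hc : HasCompactSupport u) {s : ℝ} (hs : 0 ≤ s) :
    volume {x | s < u x} ≠ ∞ := by
  refine ne_top_of_le_ne_top hc.measure_lt_top.ne (measure_mono fun x hx => subset_tsupport _ ?_)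
  have : s < u x := hx
  exact (hs.trans_lt this).ne'

lemma superlevel_step {u : Euc 2 → ℝ} (hu : ContDiff ℝ 2 u) (hc : HasCompactSupport u)
    {a b M : ℝ} (ha : 0 ≤ a) (hab : a < b) (hM : ∫ x, max (-lapl 2 u x) 0 ≤ M)
    {ρ : ℝ → ℝ} (hρ : Continuous ρ) (hρ0 : ∀ t, 0 ≤ ρ t) (hρ1 : ∀ t, ρ t ≤ 1)
    (hρa : ∀ t ≤ a, ρ t = 0) (hρb : ∀ t, b ≤ t → ρ t = 0) (hm : 0 < ∫ t in a..b, ρ t) :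
    (4 * Real.pi * (∫ t in a..b, ρ t) + M) * (volume {x | b < u x}).toReal ≤
      M * (volume {x | a < u x}).toReal := by
  set m := ∫ t in a..b, ρ t with hm_def
  set g : ℝ → ℝ := fun t => ∫ s in a..t, ρ s with hg_def
  have hρi : ∀ c d : ℝ, IntervalIntegrable ρ volume c d := fun c d => hρ.intervalIntegrable c d
  have hgd : ∀ t, HasDerivAt g (ρ t) t := fun t =>
    intervalIntegral.integral_hasDerivAt_right (hρi _ _) (hρ.stronglyMeasurableAtFilter _ _)
      hρ.continuousAt
  have hgle : ∀ t ≤ a, g t = 0 := by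
    intro t ht
    refine (intervalIntegral.integral_congr (g := fun _ => 0) fun s hs => ?_).trans (by simp)
    rw [Set.uIcc_of_ge ht] at hs
    exact hρa s hs.2
  have hgge : ∀ t, b ≤ t → g t = m := by
    intro t ht
    have h0 : ∫ s in b..t, ρ s = 0 := by
      refine (intervalIntegral.integral_congr (g := fun _ => 0) fun s hs => ?_).trans (by simp)
      rw [Set.uIcc_of_le ht] at hs
      exact hρb s hs.1
    rw [hg_def, hm_def]
    simp only
    rw [← intervalIntegral.integral_add_adjacent_intervals (hρi a b) (hρi b t), h0, add_zero]
  have hgmono : Monotone g := monotone_of_deriv_nonneg (fun t => (hgd t).differentiableAt)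
    fun t => by rw [(hgd t).deriv]; exact hρ0 t
  have hg0 : ∀ t, 0 ≤ g t := fun t => by
    rcases le_total t a with h | h
    · exact (hgle t h).ge
    · rw [← hgle a le_rfl]; exact hgmono h
  have hgm : ∀ t, g t ≤ m := fun t => by
    rcases le_total b t with h | h
    · exact (hgge t h).le
    · rw [← hgge b le_rfl]; exact hgmono h
  have hgc : ContDiff ℝ 1 g := by
    rw [contDiff_one_iff_deriv]
    refine ⟨fun t => (hgd t).differentiableAt, ?_⟩
    rwa [funext fun t => (hgd t).deriv]
  have hρz : ρ 0 = 0 := hρa 0 ha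
  have hfu : Continuous (fderiv ℝ u) := hu.continuous_fderiv two_ne_zero
  have hGc : Continuous fun x => gradLen (fderiv ℝ u x) := continuous_gradLen.comp hfu
  have hρu : Continuous fun x => ρ (u x) := hρ.comp hu.continuous
  have hρs : HasCompactSupport fun x => ρ (u x) := hc.comp_left hρz
  have hCi : Integrable fun x => ρ (u x) := hρu.integrable_of_hasCompactSupport hρs
  have hBi : Integrable fun x => ρ (u x) * gradLen (fderiv ℝ u x) :=
    (hρu.mul hGc).integrable_of_hasCompactSupport hρs.mul_right
  have hAi : Integrable fun x => ρ (u x) * gradLen (fderiv ℝ u x) ^ 2 :=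
    (hρu.mul (hGc.pow 2)).integrable_of_hasCompactSupport hρs.mul_right
  set A := ∫ x, ρ (u x) * gradLen (fderiv ℝ u x) ^ 2 with hA
  set B := ∫ x, ρ (u x) * gradLen (fderiv ℝ u x) with hB
  set C := ∫ x, ρ (u x) with hC
  have hC0 : 0 ≤ C := integral_nonneg fun x => hρ0 _
  have hB0 : 0 ≤ B := integral_nonneg fun x => mul_nonneg (hρ0 _) (gradLen_nonneg _)
  have hCS : B ^ 2 ≤ A * C := by
    have hq : ∀ t : ℝ, 0 ≤ A * (t * t) + (-2 * B) * t + C := by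
      intro t
      have h1 : 0 ≤ ∫ x, ρ (u x) * (t * gradLen (fderiv ℝ u x) - 1) ^ 2 :=
        integral_nonneg fun x => mul_nonneg (hρ0 _) (sq_nonneg _)
      have h2 : ∫ x, ρ (u x) * (t * gradLen (fderiv ℝ u x) - 1) ^ 2 =
          A * (t * t) + (-2 * B) * t + C := by
        have h3 : ∀ x, ρ (u x) * (t * gradLen (fderiv ℝ u x) - 1) ^ 2 =
            t * t * (ρ (u x) * gradLen (fderiv ℝ u x) ^ 2) +
              (-2 * t) * (ρ (u x) * gradLen (fderiv ℝ u x)) + ρ (u x) := fun x => by ring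
        simp_rw [h3]
        have hA' := hAi.const_mul (t * t)
        have hB' := hBi.const_mul (-2 * t)
        have e1 : ∫ x, (t * t * (ρ (u x) * gradLen (fderiv ℝ u x) ^ 2) +
              (-2 * t) * (ρ (u x) * gradLen (fderiv ℝ u x)) + ρ (u x)) =
            (∫ x, (t * t * (ρ (u x) * gradLen (fderiv ℝ u x) ^ 2) +
              (-2 * t) * (ρ (u x) * gradLen (fderiv ℝ u x)))) + C := integral_add (hA'.add hB') hCi
        rw [e1, integral_add hA' hB', integral_const_mul, integral_const_mul]
        ring
      rwa [h2] at h1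
    have := discrim_le_zero hq
    rw [discrim] at this
    nlinarith
  have hAM : A ≤ m * M := by
    have h1 : A = ∫ x, g (u x) * (-lapl 2 u x) := by
      simp_rw [mul_neg]
      rw [integral_neg, integral_comp_mul_lapl hu hc hgd hρ, neg_neg]
    have hli := integrable_lapl hu hc
    calc A ≤ ∫ x, m * max (-lapl 2 u x) 0 := by
          rw [h1]
          have hlc : Continuous (lapl 2 u) := continuous_lapl hu
          refine integral_mono ?_ ((hli.neg.pos_part).const_mul m) fun x => ?_
          · refine Continuous.integrable_of_hasCompactSupport ?_ ?_
            · exact (hgc.continuous.comp hu.continuous).mul hlc.neg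
            · exact HasCompactSupport.mul_left (hasCompactSupport_lapl hc).neg
          · exact (mul_le_mul_of_nonneg_left (le_max_left _ 0) (hg0 _)).trans
              (mul_le_mul_of_nonneg_right (hgm _) (le_max_right _ _))
        _ ≤ m * M := by rw [integral_const_mul]; gcongr
  set K := {x | b ≤ u x} with hK
  have hKm : MeasurableSet K := measurableSet_le measurable_const hu.continuous.measurable
  have hKfin : volume K ≠ ∞ := ne_top_of_le_ne_top (volume_superlevel_ne_top hc ha)
    (measure_mono fun x hx => hab.trans_le hx)
  have hiso : m * (2 * √(Real.pi * (volume K).toReal)) ≤ B := by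
    refine (isoperimetric (w := fun x => g (u x)) (hgc.comp (hu.of_le one_le_two))
      (hc.comp_left (hgle 0 ha)) hKm hKfin hm.le fun x hx => (hgge _ hx).ge).trans_eq ?_
    refine integral_congr_ae (ae_of_all _ fun x => ?_)
    have hder : HasFDerivAt (fun x => g (u x)) (ρ (u x) • fderiv ℝ u x) x :=
      (hgd (u x)).comp_hasFDerivAt x (hu.differentiable two_ne_zero x).hasFDerivAt
    simp only
    rw [hder.fderiv, gradLen_smul (hρ0 _)]
  have hCle : C ≤ (volume {x | a < u x}).toReal - (volume K).toReal := by
    have hKs : K ⊆ {x | a < u x} := fun x hx => hab.trans_le hx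
    have hLm : MeasurableSet {x | a < u x} :=
      measurableSet_lt measurable_const hu.continuous.measurable
    have h1 : volume.real ({x | a < u x} \ K) = (volume {x | a < u x}).toReal - (volume K).toReal :=
      measureReal_sdiff hKs hKm (volume_superlevel_ne_top hc ha)
    rw [← h1, ← integral_indicator_one (hLm.diff hKm)]
    refine integral_mono hCi ?_ fun x => ?_
    · rw [integrable_indicator_iff (hLm.diff hKm)]
      exact integrableOn_const (ne_top_of_le_ne_top (volume_superlevel_ne_top hc ha)
        (measure_mono Set.sdiff_subset))
    · by_cases hx : x ∈ {x | a < u x} \ K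
      · rw [Set.indicator_of_mem hx]; exact hρ1 _
      · rw [Set.indicator_of_notMem hx]
        apply le_of_eq
        by_cases h : u x ≤ a
        · exact hρa _ h
        · refine hρb _ ?_
          by_contra h'
          exact hx ⟨not_le.1 h, h'⟩
  have hKb : (volume {x | b < u x}).toReal ≤ (volume K).toReal :=
    ENNReal.toReal_mono hKfin (measure_mono fun x (hx : b < u x) => hx.le)
  have hM0 : 0 ≤ M := le_trans (integral_nonneg fun x => le_max_right _ _) hM
  have hk0 : 0 ≤ (volume K).toReal := ENNReal.toReal_nonneg
  have h1 : m ^ 2 * (4 * (Real.pi * (volume K).toReal)) ≤ m * M * C := by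
    calc m ^ 2 * (4 * (Real.pi * (volume K).toReal))
        = (m * (2 * √(Real.pi * (volume K).toReal))) ^ 2 := by
          rw [mul_pow, mul_pow, Real.sq_sqrt (by positivity)]; ring
      _ ≤ B ^ 2 := by gcongr
      _ ≤ A * C := hCS
      _ ≤ m * M * C := by gcongr
  have h2 : m * (4 * (Real.pi * (volume K).toReal)) ≤ M * C := by
    refine le_of_mul_le_mul_left ?_ hm
    linarith
  have h3 : M * C ≤ M * ((volume {x | a < u x}).toReal - (volume K).toReal) := by gcongr
  calc (4 * Real.pi * m + M) * (volume {x | b < u x}).toReal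
      ≤ (4 * Real.pi * m + M) * (volume K).toReal := by
        have := Real.pi_pos
        gcongr
    _ ≤ _ := by linarith

lemma superlevel_le {u : Euc 2 → ℝ} (hu : ContDiff ℝ 2 u) (hc : HasCompactSupport u)
    {a b M : ℝ} (ha : 0 ≤ a) (hab : a < b) (hM : ∫ x, max (-lapl 2 u x) 0 ≤ M) :
    (4 * Real.pi * (b - a) + M) * (volume {x | b < u x}).toReal ≤
      M * (volume {x | a < u x}).toReal := by
  have hδ : ∀ δ : ℝ, 0 < δ → 2 * δ < b - a →
      (4 * Real.pi * (b - a - 2 * δ) + M) * (volume {x | b < u x}).toReal ≤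
        M * (volume {x | a < u x}).toReal := by
    intro δ hδ hδ2
    set ρ : ℝ → ℝ := fun t => max 0 (min 1 (min ((t - a) / δ) ((b - t) / δ))) with hρ
    have hρc : Continuous ρ := by fun_prop
    have hρ0 : ∀ t, 0 ≤ ρ t := fun t => le_max_left _ _
    have hρ1 : ∀ t, ρ t ≤ 1 := fun t => max_le zero_le_one (min_le_left _ _)
    have hρi : ∀ c d : ℝ, IntervalIntegrable ρ volume c d := fun c d => hρc.intervalIntegrable c d
    have hm : b - a - 2 * δ ≤ ∫ t in a..b, ρ t := by
      have h1 : ∫ t in (a + δ)..(b - δ), ρ t = b - a - 2 * δ := by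
        have : ∫ t in (a + δ)..(b - δ), ρ t = ∫ t in (a + δ)..(b - δ), (1 : ℝ) := by
          refine intervalIntegral.integral_congr fun t ht => ?_
          rw [Set.uIcc_of_le (by linarith)] at ht
          have h2 : 1 ≤ (t - a) / δ := by rw [le_div_iff₀ hδ]; linarith [ht.1]
          have h3 : 1 ≤ (b - t) / δ := by rw [le_div_iff₀ hδ]; linarith [ht.2]
          simp only [hρ]
          rw [min_eq_left (le_min h2 h3), max_eq_right zero_le_one]
        rw [this]; simp; ring
      rw [← h1]
      exact intervalIntegral.integral_mono_interval (by linarith) (by linarith) (by linarith)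
        (ae_of_all _ hρ0) (hρi _ _)
    have hstep := superlevel_step hu hc ha hab hM hρc hρ0 hρ1 (fun t ht => ?_) (fun t ht => ?_)
      (by linarith)
    · refine le_trans ?_ hstep
      have := Real.pi_pos
      gcongr
    · refine max_eq_left ((min_le_right _ _).trans ((min_le_left _ _).trans ?_))
      exact div_nonpos_of_nonpos_of_nonneg (by linarith) hδ.le
    · refine max_eq_left ((min_le_right _ _).trans ((min_le_right _ _).trans ?_))
      exact div_nonpos_of_nonpos_of_nonneg (by linarith) hδ.le
  have hlim : Tendsto (fun δ : ℝ =>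
      (4 * Real.pi * (b - a - 2 * δ) + M) * (volume {x | b < u x}).toReal) (𝓝[>] 0)
      (𝓝 ((4 * Real.pi * (b - a - 2 * 0) + M) * (volume {x | b < u x}).toReal)) :=
    (Continuous.tendsto (by fun_prop) 0).mono_left nhdsWithin_le_nhds
  rw [mul_zero, sub_zero] at hlim
  refine le_of_tendsto hlim ?_
  filter_upwards [self_mem_nhdsWithin,
    nhdsWithin_le_nhds (Iio_mem_nhds (show (0 : ℝ) < (b - a) / 2 by linarith))] with δ h1 h2
  have h2 : δ < (b - a) / 2 := h2
  exact hδ δ h1 (by linarith)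

lemma superlevel_exp_decay {u : Euc 2 → ℝ} (hu : ContDiff ℝ 2 u) (hc : HasCompactSupport u)
    {M : ℝ} (hM0 : 0 < M) (hM : ∫ x, max (-lapl 2 u x) 0 ≤ M) {t : ℝ} (ht : 0 < t) :
    Real.exp (4 * Real.pi / M * t) * (volume {x | t < u x}).toReal ≤
      (volume {x | 0 < u x}).toReal := by
  have hpi := Real.pi_pos
  have hn : ∀ n : ℕ, 0 < n → (1 + 4 * Real.pi / M * t / n) ^ n * (volume {x | t < u x}).toReal ≤
      (volume {x | 0 < u x}).toReal := by
    intro n hn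
    have hn' : (0 : ℝ) < n := by exact_mod_cast hn
    have hk : ∀ k : ℕ, (1 + 4 * Real.pi / M * t / n) ^ k *
        (volume {x | k * (t / n) < u x}).toReal ≤ (volume {x | 0 < u x}).toReal := by
      intro k
      induction k with
      | zero => simp
      | succ k ih =>
        refine le_trans ?_ ih
        rw [pow_succ, mul_assoc]
        gcongr
        have h1 := superlevel_le hu hc (a := k * (t / n)) (b := (k + 1 : ℕ) * (t / n))
          (by positivity) (by push_cast; nlinarith [div_pos ht hn']) hM
        refine le_of_mul_le_mul_left ?_ hM0
        refine le_trans (le_of_eq ?_) h1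
        push_cast
        field_simp
        ring
    have := hk n
    rwa [mul_div_cancel₀ _ hn'.ne'] at this
  refine le_of_tendsto ((Real.tendsto_one_add_div_pow_exp _).mul_const _) ?_
  filter_upwards [eventually_gt_atTop 0] with n h
  exact hn n h

lemma lapl_neg {u : Euc 2 → ℝ} (x : Euc 2) : lapl 2 (fun y => -u y) x = -lapl 2 u x := by
  unfold lapl
  rw [← Finset.sum_neg_distrib]
  refine Finset.sum_congr rfl fun i _ => ?_
  rw [show (fun y => -u y) = -u from rfl, iteratedFDeriv_neg_apply]
  rfl

lemma L1norm_lapl_eq_integral {Ω : Set (Euc 2)} {u : Euc 2 → ℝ} (hs : tsupport u ⊆ Ω) :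
    L1norm 2 Ω (lapl 2 u) = ∫ x, |lapl 2 u x| := by
  refine setIntegral_eq_integral_of_forall_compl_eq_zero fun x hx => ?_
  have h1 : u =ᶠ[𝓝 x] fun _ => 0 := notMem_tsupport_iff_eventuallyEq.1 fun h => hx (hs h)
  rw [abs_eq_zero]
  unfold lapl
  refine Finset.sum_eq_zero fun i _ => ?_
  rw [(h1.iteratedFDeriv ℝ 2).eq_of_nhds]
  simp

lemma volume_abs_superlevel_le {Ω : Set (Euc 2)} (hΩ : volume Ω ≠ ∞) {u : Euc 2 → ℝ}
    (hu : ContDiff ℝ 2 u) (hc : HasCompactSupport u) (hs : tsupport u ⊆ Ω)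
    (hN : 0 < L1norm 2 Ω (lapl 2 u)) {t : ℝ} (ht : 0 < t) :
    volume {x | t < |u x|} ≤
      ENNReal.ofReal (Real.exp (-(8 * Real.pi / L1norm 2 Ω (lapl 2 u)) * t) * (volume Ω).toReal) := by
  set N := L1norm 2 Ω (lapl 2 u) with hNdef
  have hNint : N = ∫ x, |lapl 2 u x| := L1norm_lapl_eq_integral hs
  have hκ : 4 * Real.pi / (N / 2) = 8 * Real.pi / N := by field_simp; ring
  have hun : ContDiff ℝ 2 fun x => -u x := hu.neg
  have hcn : HasCompactSupport fun x => -u x := hc.neg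
  have hp := superlevel_exp_decay hu hc (half_pos hN)
    (by rw [integral_max_neg_lapl hu hc, hNint]) ht
  have hn := superlevel_exp_decay hun hcn (half_pos hN)
    (by rw [integral_max_neg_lapl hun hcn, hNint]; simp_rw [lapl_neg, abs_neg]; rfl) ht
  rw [hκ] at hp hn
  have hfp : ∀ s : ℝ, 0 ≤ s → volume {x | s < u x} ≠ ∞ := fun s => volume_superlevel_ne_top hc
  have hfn : ∀ s : ℝ, 0 ≤ s → volume {x | s < -u x} ≠ ∞ := fun s => volume_superlevel_ne_top hcn
  have hsum : (volume {x | 0 < u x}).toReal + (volume {x | 0 < -u x}).toReal ≤ (volume Ω).toReal := by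
    rw [← ENNReal.toReal_add (hfp 0 le_rfl) (hfn 0 le_rfl), ← measure_union]
    · refine ENNReal.toReal_mono hΩ (measure_mono ?_)
      rintro x (hx | hx)
      · exact hs (subset_tsupport _ (ne_of_gt hx))
      · exact hs (subset_tsupport _ (neg_ne_zero.1 (ne_of_gt hx)))
    · refine Set.disjoint_left.2 fun x (hx : 0 < u x) (hx' : 0 < -u x) => ?_
      linarith
    · exact measurableSet_lt measurable_const hun.continuous.measurable
  have hsub : {x | t < |u x|} ⊆ {x | t < u x} ∪ {x | t < -u x} := fun x (hx : t < |u x|) =>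
    (lt_abs.1 hx : t < u x ∨ t < -u x)
  refine (measure_mono hsub).trans ((measure_union_le _ _).trans ?_)
  rw [← ENNReal.ofReal_toReal (hfp t ht.le), ← ENNReal.ofReal_toReal (hfn t ht.le),
    ← ENNReal.ofReal_add ENNReal.toReal_nonneg ENNReal.toReal_nonneg]
  apply ENNReal.ofReal_le_ofReal
  have he : Real.exp (-(8 * Real.pi / N) * t) * Real.exp (8 * Real.pi / N * t) = 1 := by
    rw [← Real.exp_add]; simp
  calc (volume {x | t < u x}).toReal + (volume {x | t < -u x}).toReal
      = Real.exp (-(8 * Real.pi / N) * t) * (Real.exp (8 * Real.pi / N * t) *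
          (volume {x | t < u x}).toReal + Real.exp (8 * Real.pi / N * t) *
          (volume {x | t < -u x}).toReal) := by
        linear_combination (-(volume {x | t < u x}).toReal - (volume {x | t < -u x}).toReal) * he
    _ ≤ _ := by gcongr; linarith

lemma lintegral_exp_le_of_testFun {Ω : Set (Euc 2)} (hΩ : volume Ω ≠ ∞)
    {u : Euc 2 → ℝ} (hu : ContDiff ℝ 2 u) (hc : HasCompactSupport u) (hs : tsupport u ⊆ Ω)
    (hN : 0 < L1norm 2 Ω (lapl 2 u)) {α : ℝ} (hα0 : 0 < α) (hα : α < 8 * Real.pi) :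
    ∫⁻ x in Ω, ENNReal.ofReal (Real.exp (α * |u x| / L1norm 2 Ω (lapl 2 u))) ≤
      ENNReal.ofReal ((8 * Real.pi / (8 * Real.pi - α)) * (volume Ω).toReal) := by
  set N := L1norm 2 Ω (lapl 2 u) with hNdef
  set V := (volume Ω).toReal with hV
  have hV0 : 0 ≤ V := ENNReal.toReal_nonneg
  have hpi := Real.pi_pos
  set β := α / N with hβ
  have hβ0 : 0 < β := by positivity
  have hneg : β - 8 * Real.pi / N < 0 := by
    rw [hβ, ← sub_div]
    exact div_neg_of_neg_of_pos (by linarith) hN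
  have hexpInt : ∀ s : ℝ, ∫ t in (0 : ℝ)..s, β * Real.exp (β * t) = Real.exp (β * s) - 1 := by
    intro s
    have h3 : ∀ t : ℝ, HasDerivAt (fun t : ℝ => Real.exp (β * t)) (β * Real.exp (β * t)) t := by
      intro t
      convert! ((hasDerivAt_id t).const_mul β).exp using 1
      simp; ring
    rw [intervalIntegral.integral_eq_sub_of_hasDerivAt (fun θ _ => h3 θ)
      ((by fun_prop : Continuous _).intervalIntegrable _ _)]
    simp
  have hexp : ∀ x, ENNReal.ofReal (Real.exp (α * |u x| / N)) =
      1 + ENNReal.ofReal (∫ t in (0 : ℝ)..|u x|, β * Real.exp (β * t)) := by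
    intro x
    have h1 : 1 ≤ Real.exp (β * |u x|) := Real.one_le_exp (by positivity)
    rw [hexpInt, ← ENNReal.ofReal_one, ← ENNReal.ofReal_add zero_le_one (by linarith)]
    congr 1
    rw [hβ, add_sub_cancel]
    congr 1; ring
  simp_rw [hexp]
  rw [lintegral_add_left measurable_const, setLIntegral_const, one_mul,
    lintegral_comp_eq_lintegral_meas_lt_mul (f := fun x => |u x|) (g := fun t => β * Real.exp (β * t)) _
      (ae_of_all _ fun x => abs_nonneg _) hu.continuous.abs.measurable.aemeasurable
      (fun t _ => (by fun_prop : Continuous _).intervalIntegrable _ _)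
      (ae_of_all _ fun t => by positivity)]
  have hdecay : ∫⁻ t in Set.Ioi (0 : ℝ), volume.restrict Ω {x | t < |u x|} *
      ENNReal.ofReal (β * Real.exp (β * t)) ≤
      ∫⁻ t in Set.Ioi (0 : ℝ), ENNReal.ofReal (V * β * Real.exp ((β - 8 * Real.pi / N) * t)) := by
    refine setLIntegral_mono' measurableSet_Ioi fun t ht => ?_
    refine (mul_le_mul_left ((Measure.restrict_apply_le _ _).trans
      (volume_abs_superlevel_le hΩ hu hc hs hN ht)) _).trans (le_of_eq ?_)
    rw [← ENNReal.ofReal_mul (by positivity)]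
    congr 1
    rw [sub_mul, sub_eq_add_neg, Real.exp_add, ← hV, ← hNdef, neg_mul]
    ring
  rw [← ofReal_integral_eq_lintegral_ofReal ((integrableOn_exp_mul_Ioi hneg 0).const_mul _)
    (ae_of_all _ fun t => by simp only [Pi.zero_apply]; positivity), integral_const_mul,
    integral_exp_mul_Ioi hneg] at hdecay
  refine (add_le_add le_rfl hdecay).trans ?_
  rw [← ENNReal.ofReal_toReal hΩ, ← ENNReal.ofReal_add hV0]
  · apply ENNReal.ofReal_le_ofReal
    apply le_of_eq
    have h1 : 8 * Real.pi - α ≠ 0 := by linarith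
    have h2 : β - 8 * Real.pi / N = -((8 * Real.pi - α) / N) := by rw [hβ]; ring
    rw [h2, hβ]
    simp only [mul_zero, Real.exp_zero]
    field_simp
    ring
  · refine mul_nonneg (by positivity) ?_
    rw [mul_zero, Real.exp_zero]
    exact div_nonneg_of_nonpos (by norm_num) hneg.le

/-- The exponential integral inequality on the closure of the test functions. -/
lemma lintegral_exp_le {Ω : Set (Euc 2)} (hΩ : volume Ω ≠ ∞)
    {u f : Euc 2 → ℝ} (huf : MemW21Delta0 2 Ω u f) (hN : L1norm 2 Ω f ≠ 0)
    {α : ℝ} (hα0 : 0 < α) (hα : α < 8 * Real.pi) :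
    ∫⁻ x in Ω, ENNReal.ofReal (Real.exp (α * |u x| / L1norm 2 Ω f)) ≤
      ENNReal.ofReal ((8 * Real.pi / (8 * Real.pi - α)) * (volume Ω).toReal) := by
  obtain ⟨hui, hfi, φ, hφ, hφu, hφf⟩ := huf
  have hφ2 : ∀ k, ContDiff ℝ 2 (φ k) := fun k => contDiff_infty.1 (hφ k).1 2
  have hφi : ∀ k, IntegrableOn (φ k) Ω := fun k =>
    ((hφ2 k).continuous.integrable_of_hasCompactSupport (hφ k).2.1).integrableOn
  have hli : ∀ k, IntegrableOn (lapl 2 (φ k)) Ω := fun k =>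
    (integrable_lapl (hφ2 k) (hφ k).2.1).integrableOn
  have hN0 : 0 < L1norm 2 Ω f :=
    lt_of_le_of_ne (integral_nonneg fun x => abs_nonneg _) hN.symm
  have hNlim : Tendsto (fun k => L1norm 2 Ω (lapl 2 (φ k))) atTop (𝓝 (L1norm 2 Ω f)) := by
    rw [tendsto_iff_dist_tendsto_zero]
    refine squeeze_zero (fun k => dist_nonneg) (fun k => ?_) hφf
    rw [Real.dist_eq, L1norm, L1norm, ← integral_sub (hli k).abs hfi.abs]
    refine (abs_integral_le_integral_abs).trans ?_
    refine integral_mono ((hli k).abs.sub hfi.abs).abs ((hli k).sub hfi).abs fun x => ?_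
    exact abs_abs_sub_abs_le _ _
  have hmeas : TendstoInMeasure (volume.restrict Ω) φ atTop u := by
    refine tendstoInMeasure_of_tendsto_eLpNorm (p := 1) one_ne_zero
      (fun k => (hφi k).aestronglyMeasurable) hui.aestronglyMeasurable ?_
    have h1 : ∀ k, eLpNorm (φ k - u) 1 (volume.restrict Ω) =
        ENNReal.ofReal (∫ x in Ω, |φ k x - u x|) := by
      intro k
      rw [eLpNorm_one_eq_lintegral_enorm,
        ← ofReal_integral_norm_eq_lintegral_enorm ((hφi k).sub hui)]
      rfl
    simp_rw [h1]
    simpa using ENNReal.tendsto_ofReal hφu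
  obtain ⟨ns, hns, hae⟩ := hmeas.exists_seq_tendsto_ae
  have hNns := hNlim.comp hns.tendsto_atTop
  have hptw : ∀ᵐ x ∂(volume.restrict Ω), ENNReal.ofReal (Real.exp (α * |u x| / L1norm 2 Ω f)) =
      liminf (fun k => ENNReal.ofReal
        (Real.exp (α * |φ (ns k) x| / L1norm 2 Ω (lapl 2 (φ (ns k)))))) atTop := by
    filter_upwards [hae] with x hx
    refine (Tendsto.liminf_eq ?_).symm
    refine ENNReal.tendsto_ofReal ?_
    exact (Real.continuous_exp.tendsto _).comp ((hx.abs.const_mul α).div hNns hN)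
  rw [lintegral_congr_ae hptw]
  refine (lintegral_liminf_le fun k => ?_).trans ?_
  · have := (hφ2 (ns k)).continuous
    exact ENNReal.measurable_ofReal.comp (Continuous.measurable (by fun_prop))
  · refine liminf_le_of_frequently_le' (Eventually.frequently ?_)
    filter_upwards [hNns.eventually (lt_mem_nhds hN0)] with k hk
    exact lintegral_exp_le_of_testFun hΩ (hφ2 _) (hφ _).2.1 (hφ _).2.2 hk hα0 hα

lemma lintegral_comp_norm_sq {G : ℝ → ℝ≥0∞} (hG : Measurable G) (x₀ : Euc 2) :
    ∫⁻ x : Euc 2, G (‖x - x₀‖ ^ 2) =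
      ENNReal.ofReal Real.pi * ∫⁻ s in Set.Ioi (0 : ℝ), G s := by
  rw [lintegral_sub_right_eq_self (fun x : Euc 2 => G (‖x‖ ^ 2)) x₀, lintegral_eq_polar]
  simp_rw [norm_polarPt_sq]
  have himg : (fun r : ℝ => r ^ 2) '' Set.Ioi 0 = Set.Ioi 0 := by
    ext s
    constructor
    · rintro ⟨r, hr, rfl⟩
      exact pow_pos (Set.mem_Ioi.1 hr) 2
    · intro hs
      exact ⟨√s, Real.sqrt_pos.2 hs, Real.sq_sqrt (le_of_lt hs)⟩
  have hsub := lintegral_image_eq_lintegral_abs_deriv_mul measurableSet_Ioi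
    (fun r _ => (hasDerivAt_pow 2 r).hasDerivWithinAt)
    (fun r (hr : 0 < r) s (hs : 0 < s) h => (pow_left_inj₀ hr.le hs.le two_ne_zero).1 h) G
  rw [himg] at hsub
  rw [Measure.volume_eq_prod, ← Measure.prod_restrict, lintegral_prod _ (by fun_prop), hsub,
    ← lintegral_const_mul _ (by fun_prop)]
  refine setLIntegral_congr_fun measurableSet_Ioi fun r (hr : 0 < r) => ?_
  simp only [lintegral_const, Measure.restrict_apply_univ, Real.volume_Ioo]
  rw [mul_right_comm, ← mul_assoc, ← ENNReal.ofReal_mul hr.le, ← ENNReal.ofReal_mul Real.pi_pos.le]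
  congr 2
  rw [abs_of_pos (by positivity)]
  norm_num
  ring

lemma hasFDerivAt_radial {p : ℝ → ℝ} {p' : ℝ} (x₀ x : Euc 2) (hp : HasDerivAt p p' (‖x - x₀‖ ^ 2)) :
    HasFDerivAt (fun y => p (‖y - x₀‖ ^ 2)) (p' • (2 : ℝ) • innerSL ℝ (x - x₀)) x := by
  have h1 : HasFDerivAt (fun y : Euc 2 => ‖y - x₀‖ ^ 2) ((2 : ℝ) • innerSL ℝ (x - x₀)) x := by
    have := ((hasFDerivAt_id x).sub_const x₀).norm_sq
    convert! this using 1
    ext; simp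
  exact hp.comp_hasFDerivAt x h1

lemma lapl_radial {p : ℝ → ℝ} (hp : ContDiff ℝ 2 p) (x₀ x : Euc 2) :
    lapl 2 (fun y => p (‖y - x₀‖ ^ 2)) x =
      4 * deriv (fun s => s * deriv p s) (‖x - x₀‖ ^ 2) := by
  have hd : ∀ s, HasDerivAt p (deriv p s) s := fun s =>
    (hp.differentiable two_ne_zero s).hasDerivAt
  have hp1 : ContDiff ℝ 1 (deriv p) := by
    have : ContDiff ℝ (1 + 1) p := by simpa [one_add_one_eq_two] using hp
    exact (contDiff_succ_iff_deriv.1 this).2.2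
  have hd2 : ∀ s, HasDerivAt (deriv p) (deriv (deriv p) s) s := fun s =>
    (hp1.differentiable one_ne_zero s).hasDerivAt
  have hu : ContDiff ℝ 2 fun y : Euc 2 => p (‖y - x₀‖ ^ 2) :=
    hp.comp ((contDiff_id.sub contDiff_const).norm_sq ℝ)
  have h1 : ∀ i : Fin 2, (fun y => fderiv ℝ (fun y : Euc 2 => p (‖y - x₀‖ ^ 2)) y
      (EuclideanSpace.single i 1)) = fun y => deriv p (‖y - x₀‖ ^ 2) * (2 * (y i - x₀ i)) := by
    intro i
    ext y
    rw [(hasFDerivAt_radial x₀ y (hd _)).fderiv]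
    simp [EuclideanSpace.inner_single_right]
  have h2 : ∀ i : Fin 2, fderiv ℝ (fun y : Euc 2 => deriv p (‖y - x₀‖ ^ 2) * (2 * (y i - x₀ i))) x
      (EuclideanSpace.single i 1) = deriv p (‖x - x₀‖ ^ 2) * 2 +
        4 * (x i - x₀ i) ^ 2 * deriv (deriv p) (‖x - x₀‖ ^ 2) := by
    intro i
    have h3 : HasFDerivAt (fun y : Euc 2 => 2 * (y i - x₀ i))
        ((2 : ℝ) • EuclideanSpace.proj (𝕜 := ℝ) i) x :=
      (((EuclideanSpace.proj (𝕜 := ℝ) i : Euc 2 →L[ℝ] ℝ).hasFDerivAt (x := x)).sub_const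
        (x₀ i)).const_mul 2
    rw [((hasFDerivAt_radial x₀ x (hd2 _)).fun_mul h3).fderiv]
    simp [EuclideanSpace.inner_single_right]
    ring
  have h4 : deriv (fun s => s * deriv p s) (‖x - x₀‖ ^ 2) =
      deriv p (‖x - x₀‖ ^ 2) + ‖x - x₀‖ ^ 2 * deriv (deriv p) (‖x - x₀‖ ^ 2) := by
    have := ((hasDerivAt_id' (‖x - x₀‖ ^ 2)).fun_mul (hd2 (‖x - x₀‖ ^ 2))).deriv
    simpa using this
  have h5 : ‖x - x₀‖ ^ 2 = (x 0 - x₀ 0) ^ 2 + (x 1 - x₀ 1) ^ 2 := by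
    rw [EuclideanSpace.norm_sq_eq, Fin.sum_univ_two]
    simp
  rw [lapl_eq_sum_fderiv hu, h4]
  simp_rw [h1, h2]
  rw [Fin.sum_univ_two, h5]
  ring

/-- A smooth truncation of `s ↦ log (d / s)` at the scales `a`, `c` and `d`. -/
lemma exists_log_profile {a c d : ℝ} (ha : 0 < a) (hac : a < c) (hcd : c < d) :
    ∃ p : ℝ → ℝ, ContDiff ℝ (⊤ : ℕ∞) p ∧ (∀ s, d ≤ s → p s = 0) ∧
      (∀ s ∈ Set.Ioc a c, Real.log (c / s) ≤ p s) ∧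
      ∫⁻ s in Set.Ioi (0 : ℝ), ENNReal.ofReal |4 * deriv (fun s => s * deriv p s) s| =
        ENNReal.ofReal 8 := by
  set A : ℝ → ℝ := fun s => Real.smoothTransition (s / (a / 2) - 1) with hA
  set B : ℝ → ℝ := fun s => Real.smoothTransition ((d - s) / (d - c)) with hB
  have hdc : 0 < d - c := sub_pos.2 hcd
  have hAs : ContDiff ℝ (⊤ : ℕ∞) A :=
    Real.smoothTransition.contDiff.comp (by fun_prop)
  have hBs : ContDiff ℝ (⊤ : ℕ∞) B :=
    Real.smoothTransition.contDiff.comp (by fun_prop)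
  have hA0 : ∀ s ≤ a / 2, A s = 0 := fun s hs => Real.smoothTransition.zero_of_nonpos (by
    rw [sub_nonpos, div_le_one (by positivity)]; exact hs)
  have hA1 : ∀ s, a ≤ s → A s = 1 := fun s hs => Real.smoothTransition.one_of_one_le (by
    rw [le_sub_iff_add_le, le_div_iff₀ (by positivity)]; linarith)
  have hB0 : ∀ s, d ≤ s → B s = 0 := fun s hs => Real.smoothTransition.zero_of_nonpos
    (div_nonpos_of_nonpos_of_nonneg (by linarith) hdc.le)
  have hB1 : ∀ s ≤ c, B s = 1 := fun s hs => Real.smoothTransition.one_of_one_le (by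
    rw [le_div_iff₀ hdc]; linarith)
  have hAm : Monotone A := fun s t hst => Real.smoothTransition.monotone (by gcongr)
  have hBm : Antitone B := fun s t hst => Real.smoothTransition.monotone (by gcongr)
  set ψ : ℝ → ℝ := fun s => A s * B s with hψ
  have hψ0 : ∀ s, 0 ≤ ψ s := fun s =>
    mul_nonneg (Real.smoothTransition.nonneg _) (Real.smoothTransition.nonneg _)
  have hψA : ∀ s ≤ a / 2, ψ s = 0 := fun s hs => by simp [hψ, hA0 s hs]
  have hψB : ∀ s, d ≤ s → ψ s = 0 := fun s hs => by simp [hψ, hB0 s hs]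
  have hψ1 : ∀ s, a ≤ s → s ≤ c → ψ s = 1 := fun s h1 h2 => by simp [hψ, hA1 s h1, hB1 s h2]
  have hψAB : ψ = fun s => A s + B s - 1 := by
    ext s
    rcases le_total s c with h | h
    · simp [hψ, hB1 s h]
    · simp [hψ, hA1 s (hac.le.trans h)]
  set q : ℝ → ℝ := fun s => ψ s / s with hq
  have hqs : ContDiff ℝ (⊤ : ℕ∞) q := by
    refine contDiff_iff_contDiffAt.2 fun s => ?_
    rcases lt_or_ge s (a / 2) with h | h
    · refine (contDiffAt_const (c := (0 : ℝ))).congr_of_eventuallyEq ?_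
      filter_upwards [eventually_lt_nhds h] with t ht
      simp [hq, hψA t ht.le]
    · exact (hAs.mul hBs).contDiffAt.div contDiffAt_id (by linarith)
  have hq0 : ∀ s, 0 ≤ q s := fun s => by
    rcases lt_or_ge s (a / 2) with h | h
    · simp [hq, hψA s h.le]
    · exact div_nonneg (hψ0 s) (by linarith)
  have hqi : ∀ s t, IntervalIntegrable q volume s t := fun s t =>
    hqs.continuous.intervalIntegrable s t
  set p : ℝ → ℝ := fun s => -∫ t in d..s, q t with hp
  have hpd : ∀ s, HasDerivAt p (-q s) s := fun s =>
    (hqs.continuous.integral_hasStrictDerivAt d s).hasDerivAt.neg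
  have hp' : deriv p = fun s => -q s := funext fun s => (hpd s).deriv
  have hsp : (fun s => s * deriv p s) = fun s => -ψ s := by
    ext s
    rw [hp']
    rcases eq_or_ne s 0 with rfl | h
    · simp [hψA 0 (by positivity)]
    · simp only [hq]; field_simp
  refine ⟨p, ?_, ?_, ?_, ?_⟩
  · rw [contDiff_infty_iff_deriv, hp']
    exact ⟨fun s => (hpd s).differentiableAt, hqs.neg⟩
  · intro s hs
    rw [hp, neg_eq_zero]
    refine intervalIntegral.integral_zero_ae (ae_of_all _ fun t ht => ?_)
    rw [Set.uIoc_of_le hs] at ht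
    simp [hq, hψB t ht.1.le]
  · intro s hs
    have hs0 : 0 < s := ha.trans hs.1
    calc Real.log (c / s) = ∫ t in s..c, 1 / t := by
          rw [integral_one_div_of_pos hs0 (hs0.trans_le hs.2)]
      _ = ∫ t in s..c, q t := by
          refine intervalIntegral.integral_congr fun t ht => ?_
          rw [Set.uIcc_of_le hs.2] at ht
          simp only [hq]
          rw [hψ1 t (hs.1.le.trans ht.1) ht.2]
      _ ≤ ∫ t in s..d, q t := intervalIntegral.integral_mono_interval le_rfl hs.2 hcd.le
          (ae_of_all _ hq0) (hqi _ _)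
      _ = p s := by exact intervalIntegral.integral_symm d s
  · have hAd : ∀ s, HasDerivAt A (deriv A s) s := fun s =>
      (hAs.differentiable (by simp) s).hasDerivAt
    have hBd : ∀ s, HasDerivAt B (deriv B s) s := fun s =>
      (hBs.differentiable (by simp) s).hasDerivAt
    have hA'c : Continuous (deriv A) := hAs.continuous_deriv (by simp)
    have hB'c : Continuous (deriv B) := hBs.continuous_deriv (by simp)
    have hA' : ∀ s, a < s → deriv A s = 0 := fun s hs => by
      have : A =ᶠ[𝓝 s] fun _ => 1 := by
        filter_upwards [eventually_gt_nhds hs] with t ht using hA1 t ht.le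
      rw [this.deriv_eq, deriv_const]
    have hB' : ∀ s < c, deriv B s = 0 := fun s hs => by
      have : B =ᶠ[𝓝 s] fun _ => 1 := by
        filter_upwards [eventually_lt_nhds hs] with t ht using hB1 t ht.le
      rw [this.deriv_eq, deriv_const]
    have hB'd : ∀ s, d < s → deriv B s = 0 := fun s hs => by
      have : B =ᶠ[𝓝 s] fun _ => 0 := by
        filter_upwards [eventually_gt_nhds hs] with t ht using hB0 t ht.le
      rw [this.deriv_eq, deriv_const]
    have hA'0 : ∀ s, 0 ≤ deriv A s := fun s => hAm.deriv_nonneg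
    have hB'0 : ∀ s, deriv B s ≤ 0 := fun s => hBm.deriv_nonpos
    have hder : ∀ s, |4 * deriv (fun s => s * deriv p s) s| = 4 * deriv A s - 4 * deriv B s := by
      intro s
      have h1 : deriv (fun s => s * deriv p s) s = -(deriv A s + deriv B s) := by
        rw [hsp, hψAB]
        exact (((hAd s).add (hBd s)).sub_const 1).neg.deriv
      rw [h1, abs_mul, abs_neg, abs_of_pos (by norm_num : (0 : ℝ) < 4)]
      rcases lt_or_ge s c with h | h
      · rw [hB' s h, add_zero, abs_of_nonneg (hA'0 s)]; ring
      · rw [hA' s (hac.trans_le h), zero_add, abs_of_nonpos (hB'0 s)]; ring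
    simp_rw [hder]
    have hd0 : 0 ≤ d := by linarith
    have hcont : Continuous fun s => 4 * deriv A s - 4 * deriv B s := by fun_prop
    rw [← Set.Ioc_union_Ioi_eq_Ioi hd0, lintegral_union measurableSet_Ioi
      (Set.Ioc_disjoint_Ioi le_rfl), setLIntegral_congr_fun (g := fun _ => 0) measurableSet_Ioi
      (fun s (hs : d < s) => by simp [hA' s (by linarith), hB'd s hs]), lintegral_zero, add_zero,
      ← ofReal_integral_eq_lintegral_ofReal
        ((hcont.intervalIntegrable 0 d).1)
        (ae_of_all _ fun s => by simp only [Pi.zero_apply]; linarith [hA'0 s, hB'0 s]),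
      ← intervalIntegral.integral_of_le hd0, intervalIntegral.integral_sub
        ((hA'c.const_mul 4).intervalIntegrable _ _) ((hB'c.const_mul 4).intervalIntegrable _ _),
      intervalIntegral.integral_const_mul, intervalIntegral.integral_const_mul,
      intervalIntegral.integral_eq_sub_of_hasDerivAt (fun s _ => hAd s)
        (hA'c.intervalIntegrable _ _),
      intervalIntegral.integral_eq_sub_of_hasDerivAt (fun s _ => hBd s)
        (hB'c.intervalIntegrable _ _),
      hA1 d (by linarith), hA0 0 (by positivity), hB0 d le_rfl, hB1 0 (by linarith)]
    norm_num

/-- Radial functions in `W^{2,1}_{Δ,0}` concentrating at `x₀`. -/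
lemma exists_concentrating {Ω : Set (Euc 2)} {x₀ : Euc 2} {R : ℝ} (hR : 0 < R)
    (hΩ : Metric.ball x₀ R ⊆ Ω) {a c : ℝ} (ha : 0 < a) (hac : a < c) (hcR : c < R ^ 2) :
    ∃ u f : Euc 2 → ℝ, MemW21Delta0 2 Ω u f ∧ L1norm 2 Ω f = 8 * Real.pi ∧
      ∀ α : ℝ, 0 < α → ENNReal.ofReal (Real.pi * ∫ s in a..c, (c / s) ^ (α / (8 * Real.pi))) ≤
        ∫⁻ x in Ω, ENNReal.ofReal (Real.exp (α * |u x| / (8 * Real.pi))) := by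
  obtain ⟨d, hcd, hdR⟩ := exists_between hcR
  obtain ⟨p, hps, hp0, hplog, hpint⟩ := exists_log_profile ha hac hcd
  have hpi := Real.pi_pos
  set u : Euc 2 → ℝ := fun x => p (‖x - x₀‖ ^ 2) with hu
  have hus : ContDiff ℝ (⊤ : ℕ∞) u := hps.comp ((contDiff_id.sub contDiff_const).norm_sq ℝ)
  have hu2 : ContDiff ℝ 2 u := contDiff_infty.1 hus 2
  have hsupp : Function.support u ⊆ Metric.closedBall x₀ (√d) := by
    intro x hx
    by_contra h
    rw [mem_closedBall_iff_norm, not_le] at h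
    exact hx (hp0 _ (Real.lt_sq_of_sqrt_lt h).le)
  have huc : HasCompactSupport u :=
    HasCompactSupport.of_support_subset_isCompact (isCompact_closedBall _ _) hsupp
  have htsupp : tsupport u ⊆ Ω :=
    (closure_minimal hsupp Metric.isClosed_closedBall).trans
      ((Metric.closedBall_subset_ball ((Real.sqrt_lt' hR).2 hdR)).trans hΩ)
  have hlap : ∀ x, lapl 2 u x = 4 * deriv (fun s => s * deriv p s) (‖x - x₀‖ ^ 2) :=
    lapl_radial (contDiff_infty.1 hps 2) x₀
  have hmem : MemW21Delta0 2 Ω u (lapl 2 u) :=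
    ⟨(hu2.continuous.integrable_of_hasCompactSupport huc).integrableOn,
      (integrable_lapl hu2 huc).integrableOn, fun _ => u, fun _ => ⟨hus, huc, htsupp⟩,
      by simp, by simp⟩
  refine ⟨u, lapl 2 u, hmem, ?_, fun α hα => ?_⟩
  · rw [L1norm_lapl_eq_integral htsupp, integral_eq_lintegral_of_nonneg_ae
      (ae_of_all _ fun x => abs_nonneg _) (continuous_lapl hu2).abs.aestronglyMeasurable]
    simp_rw [hlap]
    rw [lintegral_comp_norm_sq (G := fun s =>
        ENNReal.ofReal |4 * deriv (fun s => s * deriv p s) s|)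
        (by have := measurable_deriv (fun s => s * deriv p s); fun_prop), hpint,
      ← ENNReal.ofReal_mul hpi.le, ENNReal.toReal_ofReal (by positivity), mul_comm]
  · set γ := α / (8 * Real.pi) with hγ
    have hγ0 : 0 < γ := by positivity
    set G : ℝ → ℝ≥0∞ := (Set.Ioc a c).indicator fun s => ENNReal.ofReal ((c / s) ^ γ) with hG
    have hGm : Measurable G := Measurable.indicator (by fun_prop) measurableSet_Ioc
    have hpos : ∀ s ∈ Set.Icc a c, 0 < c / s := fun s hs =>
      div_pos (by linarith) (by linarith [hs.1])
    have hGInt : IntervalIntegrable (fun s => (c / s) ^ γ) volume a c := by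
      refine ContinuousOn.intervalIntegrable ?_
      rw [Set.uIcc_of_le hac.le]
      refine ContinuousOn.rpow_const ?_ fun s hs => Or.inl (hpos s hs).ne'
      exact continuousOn_const.div continuousOn_id fun s hs => (ha.trans_le hs.1).ne'
    calc ENNReal.ofReal (Real.pi * ∫ s in a..c, (c / s) ^ γ)
        = ENNReal.ofReal Real.pi * ∫⁻ s in Set.Ioi (0 : ℝ), G s := by
          rw [ENNReal.ofReal_mul hpi.le, hG, lintegral_indicator measurableSet_Ioc,
            Measure.restrict_restrict measurableSet_Ioc, Set.inter_eq_left.2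
              (show Set.Ioc a c ⊆ Set.Ioi 0 from fun s hs => ha.trans hs.1),
            intervalIntegral.integral_of_le hac.le,
            ofReal_integral_eq_lintegral_ofReal hGInt.1]
          filter_upwards [ae_restrict_mem measurableSet_Ioc] with s hs
          exact Real.rpow_nonneg (hpos s ⟨hs.1.le, hs.2⟩).le _
      _ = ∫⁻ x : Euc 2, G (‖x - x₀‖ ^ 2) := (lintegral_comp_norm_sq hGm x₀).symm
      _ = ∫⁻ x in Ω, G (‖x - x₀‖ ^ 2) := by
          refine (setLIntegral_eq_of_support_subset ?_).symm
          intro x hx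
          have hx' : ‖x - x₀‖ ^ 2 ∈ Set.Ioc a c := by
            by_contra h
            exact hx (Set.indicator_of_notMem h _)
          refine hΩ (mem_ball_iff_norm.2 ?_)
          exact lt_of_pow_lt_pow_left₀ 2 hR.le (hx'.2.trans_lt hcR)
      _ ≤ _ := by
          refine lintegral_mono fun x => ?_
          by_cases hx : ‖x - x₀‖ ^ 2 ∈ Set.Ioc a c
          · rw [hG, Set.indicator_of_mem hx]
            apply ENNReal.ofReal_le_ofReal
            rw [Real.rpow_def_of_pos (hpos _ ⟨hx.1.le, hx.2⟩), mul_div_right_comm, ← hγ, mul_comm]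
            gcongr
            exact (hplog _ hx).trans (le_abs_self _)
          · rw [hG, Set.indicator_of_notMem hx]
            exact zero_le

lemma integral_div_rpow {ε c γ : ℝ} (hε : 0 < ε) (hε1 : ε < 1) (hc : 0 < c) (hγ1 : γ < 1) :
    ∫ s in ε * c..c, (c / s) ^ γ = c * ((1 - ε ^ (1 - γ)) / (1 - γ)) := by
  have hle : ε * c ≤ c := by nlinarith
  have h1 : ∫ s in ε * c..c, (c / s) ^ γ = ∫ s in ε * c..c, c ^ γ * s ^ (-γ) := by
    refine intervalIntegral.integral_congr fun s hs => ?_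
    rw [Set.uIcc_of_le hle] at hs
    have hs0 : 0 < s := (mul_pos hε hc).trans_le hs.1
    rw [Real.div_rpow hc.le hs0.le, Real.rpow_neg hs0.le, div_eq_mul_inv]
  rw [h1, intervalIntegral.integral_const_mul, integral_rpow (Or.inl (by linarith)),
    neg_add_eq_sub, Real.mul_rpow hε.le hc.le]
  have h2 : c ^ γ * c ^ (1 - γ) = c := by rw [← Real.rpow_add hc]; simp
  linear_combination (1 - ε ^ (1 - γ)) / (1 - γ) * h2

/-- Brezis-Merle type inequality on W^{2,1}_{Δ,0}(Ω), Ω ⊆ ℝ² open and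
bounded: for 0 < α < 8π, ∫_Ω exp(α|u|/‖Δu‖₁) ≤ (8π/(8π-α))|Ω|; for α = 8π the supremum
of the integrals is infinite (for nonempty Ω); and if Ω is a ball the constant
8π/(8π-α) is sharp. -/
theorem stmt_14 (Ω : Set (Euc 2)) (hΩo : IsOpen Ω) (hΩb : Bornology.IsBounded Ω) :
    (∀ α : ℝ, 0 < α → α < 8 * Real.pi →
      ∀ u f : Euc 2 → ℝ, MemW21Delta0 2 Ω u f → L1norm 2 Ω f ≠ 0 →
        ∫⁻ x in Ω, ENNReal.ofReal (Real.exp (α * |u x| / L1norm 2 Ω f)) ≤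
          ENNReal.ofReal ((8 * Real.pi / (8 * Real.pi - α)) * (volume Ω).toReal)) ∧
    (Ω.Nonempty → ∀ C : ℝ≥0∞, C ≠ ⊤ → ∃ u f : Euc 2 → ℝ,
      MemW21Delta0 2 Ω u f ∧ L1norm 2 Ω f ≠ 0 ∧
        C < ∫⁻ x in Ω, ENNReal.ofReal (Real.exp (8 * Real.pi * |u x| / L1norm 2 Ω f))) ∧
    ((∃ x₀ : Euc 2, ∃ R : ℝ, 0 < R ∧ Ω = Metric.ball x₀ R) →
      ∀ α : ℝ, 0 < α → α < 8 * Real.pi → ∀ c : ℝ,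
        (∀ u f : Euc 2 → ℝ, MemW21Delta0 2 Ω u f → L1norm 2 Ω f ≠ 0 →
          ∫⁻ x in Ω, ENNReal.ofReal (Real.exp (α * |u x| / L1norm 2 Ω f)) ≤
            ENNReal.ofReal (c * (volume Ω).toReal)) →
        8 * Real.pi / (8 * Real.pi - α) ≤ c) := by
  have hpi := Real.pi_pos
  refine ⟨fun α hα0 hα u f huf hN => lintegral_exp_le hΩb.measure_lt_top.ne huf hN hα0 hα,
    fun ⟨x₀, hx₀⟩ C hC => ?_, ?_⟩
  · obtain ⟨R, hR, hball⟩ := Metric.isOpen_iff.1 hΩo x₀ hx₀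
    set c := R ^ 2 / 2 with hc
    have hc0 : 0 < c := by positivity
    set m := (C.toReal + 1) / (Real.pi * c) with hm
    have hm0 : 0 < m := div_pos (by linarith [C.toReal_nonneg]) (by positivity)
    have ha : 0 < c * Real.exp (-m) := by positivity
    have hac : c * Real.exp (-m) < c := mul_lt_of_lt_one_right hc0 (Real.exp_lt_one_iff.2 (by linarith))
    obtain ⟨u, f, huf, hN, hlow⟩ := exists_concentrating hR hball ha hac
      (by rw [hc]; linarith [pow_pos hR 2])
    refine ⟨u, f, huf, by rw [hN]; positivity, ?_⟩
    have h1 := hlow (8 * Real.pi) (by positivity)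
    have h2 : ∫ s in c * Real.exp (-m)..c, (c / s) ^ (8 * Real.pi / (8 * Real.pi)) = c * m := by
      rw [div_self (by positivity)]
      simp_rw [Real.rpow_one, div_eq_mul_inv]
      rw [intervalIntegral.integral_const_mul, integral_inv_of_pos ha hc0, Real.exp_neg]
      congr 1
      rw [show c / (c * (Real.exp m)⁻¹) = Real.exp m by field_simp, Real.log_exp]
    rw [hN]
    refine lt_of_lt_of_le ?_ h1
    rw [h2, show Real.pi * (c * m) = C.toReal + 1 by rw [hm]; field_simp,
      ENNReal.lt_ofReal_iff_toReal_lt hC]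
    linarith
  · rintro ⟨x₀, R, hR, rfl⟩ α hα0 hα c hle
    set γ := α / (8 * Real.pi) with hγ
    have hγ1 : γ < 1 := (div_lt_one (by positivity)).2 hα
    have hvol : (volume (Metric.ball x₀ R)).toReal = Real.pi * R ^ 2 := by
      rw [EuclideanSpace.volume_ball_fin_two, ENNReal.toReal_mul, ENNReal.toReal_pow,
        ENNReal.toReal_ofReal hR.le, mul_comm]
      simp [hpi.le]
    have hR2 : 0 < R ^ 2 := by positivity
    have hbound : ∀ ε ∈ Set.Ioo (0 : ℝ) 1, (1 - ε) * ((1 - ε ^ (1 - γ)) / (1 - γ)) ≤ c := by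
      intro ε hε
      have hc0 : 0 < (1 - ε) * R ^ 2 := mul_pos (by linarith [hε.2]) hR2
      obtain ⟨u, f, huf, hN, hlow⟩ := exists_concentrating hR subset_rfl
        (mul_pos hε.1 hc0) (mul_lt_of_lt_one_left hc0 hε.2)
        (mul_lt_of_lt_one_left hR2 (by linarith [hε.1]))
      have h1 := hle u f huf (by rw [hN]; positivity)
      rw [hN] at h1
      have h2 := (hlow α hα0).trans h1
      have hpos : 0 < (1 - ε) * ((1 - ε ^ (1 - γ)) / (1 - γ)) :=
        mul_pos (by linarith [hε.2]) (div_pos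
          (sub_pos.2 (Real.rpow_lt_one hε.1.le hε.2 (by linarith))) (by linarith))
      rw [← hγ, integral_div_rpow hε.1 hε.2 hc0 hγ1, hvol,
        show Real.pi * ((1 - ε) * R ^ 2 * ((1 - ε ^ (1 - γ)) / (1 - γ))) =
          (1 - ε) * ((1 - ε ^ (1 - γ)) / (1 - γ)) * (Real.pi * R ^ 2) by ring] at h2
      refine le_of_mul_le_mul_right ?_ (by positivity : 0 < Real.pi * R ^ 2)
      exact (ENNReal.ofReal_le_ofReal_iff'.1 h2).resolve_right
        (not_le.2 (mul_pos hpos (by positivity)))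
    have hlim : Tendsto (fun ε : ℝ => (1 - ε) * ((1 - ε ^ (1 - γ)) / (1 - γ))) (𝓝[>] 0)
        (𝓝 ((1 - 0) * ((1 - 0 ^ (1 - γ)) / (1 - γ)))) := by
      refine (ContinuousAt.tendsto ?_).mono_left nhdsWithin_le_nhds
      have h3 : ContinuousAt (fun ε : ℝ => ε ^ (1 - γ)) 0 :=
        Real.continuousAt_rpow_const _ _ (Or.inr (by linarith))
      exact (continuousAt_const.sub continuousAt_id).mul ((continuousAt_const.sub h3).div_const _)
    have h4 := le_of_tendsto hlim
      (by filter_upwards [Ioo_mem_nhdsGT one_pos] with ε hε using hbound ε hε)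
    have h5 : 8 * Real.pi - α ≠ 0 := by linarith
    rw [Real.zero_rpow (by linarith), hγ] at h4
    refine le_of_eq_of_le ?_ h4
    field_simp
    ring
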